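/- Let A ∈ GL(2,ℤ) be an Anosov matrix with R(A) = ∅, let M₀ ∈ GL(2,ℤ) be a primitive root of A (i.e. C(A) = {± M₀^j : j ∈ ℤ}), and suppose A = M₀^ℓ for some integer ℓ ≥ 1. Let H = (ℤ × ℤ)/((I − A)(ℤ × ℤ)), and note that M₀ induces an automorphism of H (since M₀ commutes with A) whose ℓ-th power is the identity. Then Out(E_A) is isomorphic to the iterated semidirect product (H ⋊ ℤ/ℓ) ⋊ ℤ/2, where the generator of ℤ/ℓ acts on H by the automorphism induced by M₀, and the nontrivial element of ℤ/2 acts on H by multiplication by −1 and on ℤ/ℓ as the identity. -/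

import Mathlib

open Matrix SemidirectProduct Multiplicative

abbrev GL2Z := GL (Fin 2) ℤ

/-- A matrix in `GL(2,ℤ)` is exceptional if `det = 1` and `|tr| ≤ 2`, or `det = -1` and `tr = 0`. -/
def IsExceptional (A : GL2Z) : Prop :=
  ((A : Matrix (Fin 2) (Fin 2) ℤ).det = 1 ∧ |(A : Matrix (Fin 2) (Fin 2) ℤ).trace| ≤ 2) ∨
    ((A : Matrix (Fin 2) (Fin 2) ℤ).det = -1 ∧ (A : Matrix (Fin 2) (Fin 2) ℤ).trace = 0)

/-- Anosov = not exceptional. -/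
def IsAnosov (A : GL2Z) : Prop := ¬ IsExceptional A

/-- The linear action of a 2×2 integer matrix on `ℤ × ℤ`. -/
def mulVec2 (M : Matrix (Fin 2) (Fin 2) ℤ) (p : ℤ × ℤ) : ℤ × ℤ :=
  (M 0 0 * p.1 + M 0 1 * p.2, M 1 0 * p.1 + M 1 1 * p.2)

lemma mulVec2_one (p : ℤ × ℤ) : mulVec2 1 p = p := by
  simp [mulVec2, Matrix.one_apply]

lemma mulVec2_mul (M N : Matrix (Fin 2) (Fin 2) ℤ) (p : ℤ × ℤ) :
    mulVec2 (M * N) p = mulVec2 M (mulVec2 N p) := by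
  apply Prod.ext <;>
    simp only [mulVec2, Matrix.mul_apply, Fin.sum_univ_two] <;> ring

/-- `mulVec2 M` as an additive monoid homomorphism. -/
def mulVec2Hom (M : Matrix (Fin 2) (Fin 2) ℤ) : (ℤ × ℤ) →+ (ℤ × ℤ) where
  toFun := mulVec2 M
  map_zero' := by simp [mulVec2]
  map_add' p q := by
    apply Prod.ext <;> simp only [mulVec2, Prod.fst_add, Prod.snd_add] <;> ring

/-- The additive automorphism of `ℤ × ℤ` given by an element of `GL(2,ℤ)`. -/
def glAddAut (A : GL2Z) : AddAut (ℤ × ℤ) where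
  toFun := mulVec2 (A : Matrix (Fin 2) (Fin 2) ℤ)
  invFun := mulVec2 ((A⁻¹ : GL2Z) : Matrix (Fin 2) (Fin 2) ℤ)
  left_inv p := by
    rw [← mulVec2_mul]
    rw [show ((A⁻¹ : GL2Z) : Matrix (Fin 2) (Fin 2) ℤ) * (A : Matrix (Fin 2) (Fin 2) ℤ) = 1 from
      A.inv_mul]
    exact mulVec2_one p
  right_inv p := by
    rw [← mulVec2_mul]
    rw [show (A : Matrix (Fin 2) (Fin 2) ℤ) * ((A⁻¹ : GL2Z) : Matrix (Fin 2) (Fin 2) ℤ) = 1 from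
      A.mul_inv]
    exact mulVec2_one p
  map_add' := (mulVec2Hom (A : Matrix (Fin 2) (Fin 2) ℤ)).map_add

/-- The multiplicative automorphism of `Multiplicative (ℤ × ℤ)` given by an element of
`GL(2,ℤ)`. -/
def glMulAut (A : GL2Z) : MulAut (Multiplicative (ℤ × ℤ)) :=
  AddEquiv.toMultiplicative (glAddAut A)

/-- The action of `ℤ` on `ℤ × ℤ` in which `1` acts by the matrix `A`. -/
def EAphi (A : GL2Z) : Multiplicative ℤ →* MulAut (Multiplicative (ℤ × ℤ)) :=
  zpowersHom _ (glMulAut A)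

/-- `E_A = (ℤ × ℤ) ⋊ ℤ`, where `1 : ℤ` acts by the matrix `A`. -/
abbrev EA (A : GL2Z) : Type :=
  Multiplicative (ℤ × ℤ) ⋊[EAphi A] Multiplicative ℤ

/-- The canonical subgroup `ℤ × ℤ` of `E_A`. -/
def EAsub (A : GL2Z) : Subgroup (EA A) :=
  (SemidirectProduct.inl : Multiplicative (ℤ × ℤ) →* EA A).range

/-- The inner automorphisms form a normal subgroup of `Aut(G)`. -/
instance innConjNormal (G : Type*) [Group G] :
    ((MulAut.conj : G →* MulAut G).range).Normal := by
  constructor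
  intro x hx φ
  obtain ⟨g, rfl⟩ := hx
  refine ⟨φ g, ?_⟩
  ext h
  simp [MulAut.conj, mul_assoc]

/-- The outer automorphism group `Out(G) = Aut(G)/Inn(G)`. -/
abbrev OutG (G : Type*) [Group G] : Type _ :=
  MulAut G ⧸ (MulAut.conj : G →* MulAut G).range

/-- The subgroup `(I - A)(ℤ × ℤ)` of `ℤ × ℤ`. -/
def subIA (A : GL2Z) : AddSubgroup (ℤ × ℤ) :=
  (mulVec2Hom (1 - (A : Matrix (Fin 2) (Fin 2) ℤ))).range

/-- `H = (ℤ × ℤ)/((I - A)(ℤ × ℤ))`. -/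
abbrev HGrp (A : GL2Z) : Type _ := (ℤ × ℤ) ⧸ subIA A

section Matrices

/-- The action of `GL(2,ℤ)` on `ℤ × ℤ`, written multiplicatively. -/
def glHom : GL2Z →* MulAut (Multiplicative (ℤ × ℤ)) where
  toFun := glMulAut
  map_one' := by
    ext x : 1
    exact congrArg ofAdd (mulVec2_one x.toAdd)
  map_mul' B C := by
    ext x : 1
    exact congrArg ofAdd (mulVec2_mul _ _ x.toAdd)

lemma glHom_apply (B : GL2Z) (x : Multiplicative (ℤ × ℤ)) :
    glHom B x = ofAdd (mulVec2 (B : Matrix (Fin 2) (Fin 2) ℤ) x.toAdd) := rfl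

lemma mulVec2_injective : Function.Injective mulVec2 := by
  intro M N h
  have h₁ := congrFun h (1, 0)
  have h₂ := congrFun h (0, 1)
  simp only [mulVec2, Prod.mk.injEq, mul_one, mul_zero, add_zero, zero_add] at h₁ h₂
  ext i j
  fin_cases i <;> fin_cases j <;> simp_all

lemma glHom_injective : Function.Injective glHom := by
  intro B C h
  refine Units.ext (mulVec2_injective (funext fun x => ?_))
  exact congrArg toAdd (DFunLike.congr_fun h (ofAdd x))

lemma glHom_neg_one (x : Multiplicative (ℤ × ℤ)) : glHom (-1) x = x⁻¹ := by
  rw [glHom_apply]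
  apply toAdd.injective
  ext <;> simp [mulVec2]

lemma exists_mulVec2_eq (f : (ℤ × ℤ) →+ (ℤ × ℤ)) :
    ∃ M : Matrix (Fin 2) (Fin 2) ℤ, ∀ x, mulVec2 M x = f x := by
  refine ⟨!![(f (1, 0)).1, (f (0, 1)).1; (f (1, 0)).2, (f (0, 1)).2], fun x => ?_⟩
  have hx : x = x.1 • ((1, 0) : ℤ × ℤ) + x.2 • ((0, 1) : ℤ × ℤ) := by ext <;> simp
  conv_rhs => rw [hx, map_add, map_zsmul, map_zsmul]
  ext <;> simp [mulVec2, mul_comm]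

/-- Every automorphism of `ℤ × ℤ` comes from a matrix. -/
lemma glHom_surjective : Function.Surjective glHom := by
  intro α
  obtain ⟨M, hM⟩ := exists_mulVec2_eq (MonoidHom.toAdditive α.toMonoidHom)
  obtain ⟨N, hN⟩ := exists_mulVec2_eq (MonoidHom.toAdditive α.symm.toMonoidHom)
  refine ⟨⟨M, N, mulVec2_injective ?_, mulVec2_injective ?_⟩, ?_⟩
  · funext x
    rw [mulVec2_mul, hN, hM, mulVec2_one]
    exact α.apply_symm_apply (ofAdd x)
  · funext x
    rw [mulVec2_mul, hM, hN, mulVec2_one]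
    exact α.symm_apply_apply (ofAdd x)
  · ext x : 1
    exact congrArg ofAdd (hM x.toAdd)

lemma trace_lt_trace_pow_succ {S : Matrix (Fin 2) (Fin 2) ℤ} (hdet : S.det = 1)
    (htr : 3 ≤ S.trace) (n : ℕ) :
    2 ≤ (S ^ n).trace ∧ (S ^ n).trace < (S ^ (n + 1)).trace := by
  have hrec : ∀ n : ℕ, (S ^ (n + 2)).trace = S.trace * (S ^ (n + 1)).trace - (S ^ n).trace := by
    intro n
    rw [Matrix.det_fin_two] at hdet
    rw [pow_succ _ (n + 1), pow_succ]
    simp only [Matrix.trace_fin_two, Matrix.mul_apply, Fin.sum_univ_two]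
    linear_combination -((S ^ n) 0 0 + (S ^ n) 1 1) * hdet
  induction n with
  | zero => simp; omega
  | succ n ih =>
    rw [hrec]
    have h3 := mul_le_mul_of_nonneg_right htr (show 0 ≤ (S ^ (n + 1)).trace by omega)
    exact ⟨by omega, by omega⟩

lemma IsAnosov.pow_ne_one {A : GL2Z} (hA : IsAnosov A) {n : ℕ} (hn : n ≠ 0) : A ^ n ≠ 1 := by
  intro h
  set M : Matrix (Fin 2) (Fin 2) ℤ := A.val with hM
  have hdet : M.det = 1 ∨ M.det = -1 :=
    Int.isUnit_iff.1 ((Matrix.isUnit_iff_isUnit_det _).1 A.isUnit)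
  have hS : (M ^ 2).det = 1 := by
    rw [Matrix.det_pow]; rcases hdet with h | h <;> simp [h]
  have htr2 : (M ^ 2).trace = M.trace ^ 2 - 2 * M.det := by
    simp [pow_two, Matrix.mul_apply, Fin.sum_univ_two, Matrix.trace_fin_two, Matrix.det_fin_two]
    ring
  have htr : 3 ≤ (M ^ 2).trace := by
    rw [htr2]
    simp only [IsAnosov, IsExceptional, not_or, not_and, not_le, ← hM] at hA
    rcases hdet with h | h
    · have h3 := hA.1 h
      rw [h, ← sq_abs]; nlinarith
    · have h3 := sq_pos_of_ne_zero (hA.2 h)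
      rw [h]; omega
  obtain ⟨m, rfl⟩ := Nat.exists_eq_succ_of_ne_zero hn
  have h1 : (M ^ 2) ^ (m + 1) = 1 := by
    rw [← pow_mul, mul_comm, pow_mul]
    have : M ^ (m + 1) = 1 := by simpa using congrArg Units.val h
    rw [this, one_pow]
  have h2 := trace_lt_trace_pow_succ hS htr m
  rw [h1] at h2
  simp at h2
  omega

lemma IsAnosov.det_one_sub_ne_zero {A : GL2Z} (hA : IsAnosov A) :
    (1 - (A : Matrix (Fin 2) (Fin 2) ℤ)).det ≠ 0 := by
  intro h
  set M : Matrix (Fin 2) (Fin 2) ℤ := A.val with hM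
  have hdet : M.det = 1 ∨ M.det = -1 :=
    Int.isUnit_iff.1 ((Matrix.isUnit_iff_isUnit_det _).1 A.isUnit)
  have h' : 1 - M.trace + M.det = 0 := by
    rw [← h]
    simp [Matrix.trace_fin_two, Matrix.det_fin_two]
    ring
  apply hA
  rcases hdet with hd | hd
  · exact Or.inl ⟨hd, by rw [← hM, show M.trace = 2 by omega]; norm_num⟩
  · exact Or.inr ⟨hd, by rw [← hM]; omega⟩

/-- A homomorphism from `ℤ × ℤ` to `ℤ` that is invariant under an Anosov matrix is trivial. -/
lemma IsAnosov.invariant_hom_trivial {A : GL2Z} (hA : IsAnosov A)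
    (χ : Multiplicative (ℤ × ℤ) →* Multiplicative ℤ) (hχ : ∀ x, χ (glHom A x) = χ x) (x) :
    χ x = 1 := by
  set M : Matrix (Fin 2) (Fin 2) ℤ := A.val with hM
  have hzero : ∀ y : ℤ × ℤ, χ (ofAdd (mulVec2 (1 - M) y)) = 1 := by
    intro y
    have : ofAdd (mulVec2 (1 - M) y) = ofAdd y * (glHom A (ofAdd y))⁻¹ := by
      rw [glHom_apply]
      apply toAdd.injective
      ext <;> simp [mulVec2, ← hM] <;> ring
    rw [this, map_mul, map_inv, hχ, mul_inv_cancel]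
  have h := hzero (mulVec2 (1 - M).adjugate x.toAdd)
  rw [← mulVec2_mul, Matrix.mul_adjugate] at h
  have h' : ofAdd (mulVec2 ((1 - M).det • 1) x.toAdd) = x ^ (1 - M).det := by
    apply toAdd.injective
    ext <;> simp [mulVec2]
  rw [h', map_zpow] at h
  have h'' := congrArg toAdd h
  rw [toAdd_zpow, toAdd_one, smul_eq_mul] at h''
  exact toAdd.injective ((mul_eq_zero.1 h'').resolve_left hA.det_one_sub_ne_zero)

end Matrices

lemma MulAut.zpow_apply_of_semiconj {X Y : Type*} [Group X] [Group Y] (q : X → Y)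
    (τ : MulAut X) (σ : MulAut Y) (h : ∀ x, σ (q x) = q (τ x)) (k : ℤ) (x : X) :
    (σ ^ k) (q x) = q ((τ ^ k) x) := by
  induction k generalizing x with
  | zero => simp
  | succ k ih => rw [_root_.zpow_add_one, _root_.zpow_add_one, MulAut.mul_apply, h, ih, MulAut.mul_apply]
  | pred k ih =>
    rw [_root_.zpow_sub_one, _root_.zpow_sub_one, MulAut.mul_apply, MulAut.mul_apply, ← ih]
    congr 1
    apply σ.injective
    rw [MulAut.apply_inv_self, h, MulAut.apply_inv_self]

lemma exists_zmod_hom {G : Type*} [Group G] (n : ℕ) (g : G) (hg : g ^ n = 1) :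
    ∃ f : Multiplicative (ZMod n) →* G, ∀ k : ℤ, f (ofAdd (k : ZMod n)) = g ^ k := by
  refine ⟨AddMonoidHom.toMultiplicativeLeft (ZMod.lift n (A := Additive G)
    ⟨MonoidHom.toAdditiveRight (zpowersHom G g), ?_⟩), fun k => ?_⟩
  · exact congrArg Additive.ofMul (by simpa using hg)
  · simp

section Automorphisms

variable {A : GL2Z}

lemma EAphi_apply (k : ℤ) : EAphi A (ofAdd k) = glHom (A ^ k) := by
  rw [map_zpow]
  rfl

lemma inl_glHom (n : Multiplicative (ℤ × ℤ)) :
    (inl (glHom A n) : EA A) = inr (ofAdd (1 : ℤ)) * inl n * (inr (ofAdd (1 : ℤ)))⁻¹ := by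
  rw [← map_inv inr, ← inl_aut, EAphi_apply, zpow_one]

lemma conj_inl (v : Multiplicative (ℤ × ℤ)) (k : ℤ) (n : Multiplicative (ℤ × ℤ)) :
    MulAut.conj (inl v * inr (ofAdd k) : EA A) (inl n) = inl (glHom (A ^ k) n) := by
  rw [map_mul, MulAut.mul_apply, MulAut.conj_apply (inr _), ← map_inv inr, ← inl_aut,
    EAphi_apply, MulAut.conj_apply, ← map_inv, ← map_mul, ← map_mul, mul_inv_cancel_comm]

lemma conj_inr (v : Multiplicative (ℤ × ℤ)) (k : ℤ) :
    MulAut.conj (inl v * inr (ofAdd k) : EA A) (inr (ofAdd (1 : ℤ))) =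
      inl (v * (glHom A v)⁻¹) * inr (ofAdd (1 : ℤ)) := by
  have hk : MulAut.conj (inr (ofAdd k) : EA A) (inr (ofAdd (1 : ℤ))) = inr (ofAdd (1 : ℤ)) := by
    rw [MulAut.conj_apply, ← map_inv, ← map_mul, ← map_mul, mul_inv_cancel_comm]
  rw [map_mul, MulAut.mul_apply, hk, MulAut.conj_apply, map_mul, map_inv, inl_glHom]
  group

/-- Homomorphisms out of `E_A` are determined by their values on `ℤ × ℤ` and on the generator of
`ℤ`. -/
lemma EA_hom_ext {G : Type*} [Group G] {f g : EA A →* G} (hl : ∀ n, f (inl n) = g (inl n))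
    (hr : f (inr (ofAdd (1 : ℤ))) = g (inr (ofAdd (1 : ℤ)))) : f = g :=
  SemidirectProduct.hom_ext (MonoidHom.ext hl) (MonoidHom.ext_mint hr)

lemma EA_aut_ext {f g : MulAut (EA A)} (hl : ∀ n, f (inl n) = g (inl n))
    (hr : f (inr (ofAdd (1 : ℤ))) = g (inr (ofAdd (1 : ℤ)))) : f = g :=
  MulEquiv.toMonoidHom_injective (EA_hom_ext hl hr)

/-- The endomorphism of `E_A` that restricts to `B` on `ℤ × ℤ` and maps the generator `t` of `ℤ`
to `v * t`. -/
def affineEnd (v : Multiplicative (ℤ × ℤ)) (B : GL2Z) (hB : Commute B A) : EA A →* EA A :=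
  SemidirectProduct.lift (inl.comp (glHom B).toMonoidHom)
    (zpowersHom _ (inl v * inr (ofAdd (1 : ℤ)))) (by
      intro k
      refine MonoidHom.ext fun n => ?_
      have h := MulAut.zpow_apply_of_semiconj (inl : Multiplicative (ℤ × ℤ) → EA A) (glHom A)
        (MulAut.conj (inl v * inr (ofAdd (1 : ℤ)))) (fun x => by rw [conj_inl, zpow_one]) k.toAdd
        (glHom B n)
      have hk : EAphi A k = glHom (A ^ k.toAdd) := EAphi_apply k.toAdd
      simp only [MonoidHom.comp_apply, MulEquiv.coe_toMonoidHom, zpowersHom_apply, map_zpow, h, hk]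
      rw [← map_zpow, ← MulAut.mul_apply, ← MulAut.mul_apply, ← map_mul, ← map_mul,
        (hB.zpow_right _).eq])

@[simp]
lemma affineEnd_inl (v : Multiplicative (ℤ × ℤ)) (B : GL2Z) (hB : Commute B A)
    (n : Multiplicative (ℤ × ℤ)) : affineEnd v B hB (inl n) = inl (glHom B n) := by
  simp [affineEnd]

@[simp]
lemma affineEnd_inr (v : Multiplicative (ℤ × ℤ)) (B : GL2Z) (hB : Commute B A) :
    affineEnd v B hB (inr (ofAdd (1 : ℤ))) = inl v * inr (ofAdd (1 : ℤ)) := by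
  simp [affineEnd]

variable {C : Type*} [Group C]

/-- The action on `E_A` of the semidirect product of `ℤ × ℤ` and a group acting on it through the
centralizer of `A`. -/
def affineAut (ρ : C →* GL2Z) (hρ : ∀ c, Commute (ρ c) A) :
    Multiplicative (ℤ × ℤ) ⋊[glHom.comp ρ] C →* MulAut (EA A) :=
  have hmul : ∀ p q : Multiplicative (ℤ × ℤ) ⋊[glHom.comp ρ] C,
      affineEnd (p * q).left (ρ (p * q).right) (hρ _) =
        (affineEnd p.left (ρ p.right) (hρ _)).comp (affineEnd q.left (ρ q.right) (hρ _)) := by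
    intro p q
    apply EA_hom_ext
    · intro n
      simp
    · simp only [affineEnd_inr, MonoidHom.comp_apply, map_mul, affineEnd_inl, ← mul_assoc]
      rw [← map_mul inl, mul_comm _ p.left]
      rfl
  have hone : affineEnd (1 : Multiplicative (ℤ × ℤ) ⋊[glHom.comp ρ] C).left (ρ 1) (hρ _) =
      MonoidHom.id (EA A) := EA_hom_ext (by simp) (by simp)
  MonoidHom.mk' (fun p => MonoidHom.toMulEquiv (affineEnd p.left (ρ p.right) (hρ _))
      (affineEnd p⁻¹.left (ρ p⁻¹.right) (hρ _))
      (by rw [← hmul]; simpa using hone) (by rw [← hmul]; simpa using hone))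
    (fun p q => MulEquiv.toMonoidHom_injective (hmul p q))

lemma affineAut_inl (ρ : C →* GL2Z) (hρ : ∀ c, Commute (ρ c) A)
    (p : Multiplicative (ℤ × ℤ) ⋊[glHom.comp ρ] C) (n : Multiplicative (ℤ × ℤ)) :
    affineAut ρ hρ p (inl n) = inl (glHom (ρ p.right) n) :=
  affineEnd_inl _ _ (hρ _) _

lemma affineAut_inr (ρ : C →* GL2Z) (hρ : ∀ c, Commute (ρ c) A)
    (p : Multiplicative (ℤ × ℤ) ⋊[glHom.comp ρ] C) :
    affineAut ρ hρ p (inr (ofAdd (1 : ℤ))) = inl p.left * inr (ofAdd (1 : ℤ)) :=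
  affineEnd_inr _ _ (hρ _)

lemma affineAut_mem_range_conj_iff (ρ : C →* GL2Z) (hρ : ∀ c, Commute (ρ c) A)
    (p : Multiplicative (ℤ × ℤ) ⋊[glHom.comp ρ] C) :
    affineAut ρ hρ p ∈ (MulAut.conj : EA A →* MulAut (EA A)).range ↔
      (∃ u, p.left = u * (glHom A u)⁻¹) ∧ ∃ k : ℤ, ρ p.right = A ^ k := by
  constructor
  · rintro ⟨x, hx⟩
    have hx' : x = inl x.left * inr (ofAdd x.right.toAdd) := (inl_left_mul_inr_right x).symm
    rw [hx'] at hx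
    refine ⟨⟨x.left, ?_⟩, x.right.toAdd, glHom_injective (MulEquiv.ext fun n => ?_)⟩
    · have h := DFunLike.congr_fun hx (inr (ofAdd (1 : ℤ)))
      rw [conj_inr, affineAut_inr, mul_left_inj] at h
      exact (inl_injective h).symm
    · have h := DFunLike.congr_fun hx (inl n)
      rw [conj_inl, affineAut_inl] at h
      exact (inl_injective h).symm
  · rintro ⟨⟨u, hu⟩, k, hk⟩
    refine ⟨inl u * inr (ofAdd k), EA_aut_ext (fun n => ?_) ?_⟩
    · rw [conj_inl, affineAut_inl, hk]
    · rw [conj_inr, affineAut_inr, hu]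

lemma IsAnosov.aut_inl (hA : IsAnosov A) (φ : MulAut (EA A)) (n : Multiplicative (ℤ × ℤ)) :
    φ (inl n) = inl (φ (inl n)).left := by
  have h : (φ (inl n)).right = 1 :=
    hA.invariant_hom_trivial (rightHom.comp (φ.toMonoidHom.comp inl)) (fun x => by
      simp only [MonoidHom.comp_apply, inl_glHom, map_mul, map_inv]
      rw [mul_inv_cancel_comm]) n
  ext1 <;> simp [h]

lemma IsAnosov.aut_right (hA : IsAnosov A) (φ : MulAut (EA A)) (x : EA A) :
    (φ x).right = (φ (inr (ofAdd (1 : ℤ)))).right ^ x.right.toAdd := by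
  have hr : (inr x.right : EA A) = inr (ofAdd (1 : ℤ)) ^ x.right.toAdd := by
    rw [← map_zpow, ← ofAdd_zsmul]
    simp
  conv_lhs => rw [← inl_left_mul_inr_right x, map_mul, hA.aut_inl, hr, map_zpow, mul_right,
    right_inl, one_mul]
  exact map_zpow rightHom _ _

/-- If `A` is Anosov and not conjugate to its inverse, then every automorphism of `E_A` is given
by a matrix commuting with `A` and a translation. -/
lemma IsAnosov.exists_affine (hA : IsAnosov A) (hR : {B : GL2Z | B * A * B⁻¹ = A⁻¹} = ∅)
    (φ : MulAut (EA A)) :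
    ∃ v B, B * A * B⁻¹ = A ∧ (∀ n, φ (inl n) = inl (glHom B n)) ∧
      φ (inr (ofAdd (1 : ℤ))) = inl v * inr (ofAdd (1 : ℤ)) := by
  let α : MulAut (Multiplicative (ℤ × ℤ)) :=
    { toFun n := (φ (inl n)).left
      invFun n := (φ⁻¹ (inl n)).left
      left_inv n := inl_injective (φ := EAphi A) (by
        rw [← hA.aut_inl, ← hA.aut_inl, MulAut.inv_apply_self])
      right_inv n := inl_injective (φ := EAphi A) (by
        rw [← hA.aut_inl, ← hA.aut_inl, MulAut.apply_inv_self])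
      map_mul' m n := inl_injective (φ := EAphi A) (by
        rw [← hA.aut_inl, map_mul, map_mul, map_mul, ← hA.aut_inl, ← hA.aut_inl]) }
  obtain ⟨B, hB⟩ := glHom_surjective α
  have hinl : ∀ n, φ (inl n) = inl (glHom B n) := fun n => by
    rw [hB]
    exact hA.aut_inl φ n
  set v := (φ (inr (ofAdd (1 : ℤ)))).left
  set d := (φ (inr (ofAdd (1 : ℤ)))).right with hd
  have hinr : φ (inr (ofAdd (1 : ℤ))) = inl v * inr d := (inl_left_mul_inr_right _).symm
  have hunit : d.toAdd = 1 ∨ d.toAdd = -1 := by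
    have h := hA.aut_right φ (φ⁻¹ (inr (ofAdd (1 : ℤ))))
    rw [MulAut.apply_inv_self, right_inr, ← hd] at h
    have h' := congrArg toAdd h
    rw [toAdd_zpow, smul_eq_mul, toAdd_ofAdd] at h'
    exact Int.isUnit_iff.1 (IsUnit.of_mul_eq_one_right _ h'.symm)
  have hcomm : B * A = A ^ d.toAdd * B := by
    apply glHom_injective
    ext n : 1
    apply inl_injective (φ := EAphi A)
    rw [map_mul, map_mul, MulAut.mul_apply, MulAut.mul_apply, ← hinl, inl_glHom, ← conj_inl v,
      MulAut.conj_apply, map_mul, map_mul, map_inv, hinr, hinl]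
    rfl
  rcases hunit with h | h
  · refine ⟨v, B, ?_, hinl, ?_⟩
    · rw [hcomm, h, zpow_one, mul_inv_cancel_right]
    · rw [hinr, show d = ofAdd 1 from h]
  · have : B ∈ {B : GL2Z | B * A * B⁻¹ = A⁻¹} := by
      rw [Set.mem_ofPred_eq, hcomm, h, _root_.zpow_neg_one, mul_inv_cancel_right]
    rw [hR] at this
    exact this.elim

end Automorphisms

section Quotients

/-- The projection of `ℤ × ℤ` onto `H`, written multiplicatively. -/
def projH (A : GL2Z) : Multiplicative (ℤ × ℤ) →* Multiplicative (HGrp A) :=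
  AddMonoidHom.toMultiplicative (QuotientAddGroup.mk' (subIA A))

lemma projH_surjective (A : GL2Z) : Function.Surjective (projH A) := by
  intro y
  obtain ⟨x, hx⟩ := QuotientAddGroup.mk_surjective y.toAdd
  exact ⟨ofAdd x, congrArg ofAdd hx⟩

lemma projH_eq_one_iff (A : GL2Z) (x : Multiplicative (ℤ × ℤ)) :
    projH A x = 1 ↔ ∃ u, x = u * (glHom A u)⁻¹ := by
  have hsub : ∀ u : ℤ × ℤ, mulVec2 (1 - A.val) u = u - mulVec2 A.val u := by
    intro u
    ext <;> simp [mulVec2] <;> ring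
  have h : projH A x = 1 ↔ x.toAdd ∈ subIA A := QuotientAddGroup.eq_zero_iff x.toAdd
  rw [h]
  constructor
  · rintro ⟨u, hu⟩
    refine ⟨ofAdd u, toAdd.injective (hu.symm.trans ((hsub u).trans ?_))⟩
    exact sub_eq_add_neg _ _
  · rintro ⟨u, rfl⟩
    exact ⟨u.toAdd, (hsub _).trans (sub_eq_add_neg _ _)⟩

/-- A matrix commuting with `A` induces an automorphism of `H`. -/
lemma exists_induced_aut {A B : GL2Z} (h : Commute B A) :
    ∃ σ : MulAut (Multiplicative (HGrp A)), ∀ x, σ (projH A x) = projH A (glHom B x) := by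
  have hmap : ∀ C : GL2Z, Commute C A →
      subIA A ≤ (subIA A).comap (glAddAut C).toAddMonoidHom := by
    rintro C hC _ ⟨u, rfl⟩
    refine ⟨mulVec2 C.val u, ?_⟩
    have hC' : (1 - A.val) * C.val = C.val * (1 - A.val) := by
      rw [sub_mul, mul_sub, one_mul, mul_one, ← Units.val_mul, ← Units.val_mul, hC.eq]
    exact (mulVec2_mul _ _ u).symm.trans ((congrArg (mulVec2 · u) hC').trans (mulVec2_mul _ _ u))
  let f (C : GL2Z) (hC : Commute C A) : Multiplicative (HGrp A) →* Multiplicative (HGrp A) :=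
    AddMonoidHom.toMultiplicative (QuotientAddGroup.map _ _ _ (hmap C hC))
  have hf : ∀ C hC x, f C hC (projH A x) = projH A (glHom C x) := fun _ _ _ => rfl
  refine ⟨MonoidHom.toMulEquiv (f B h) (f B⁻¹ h.inv_left) ?_ ?_, hf B h⟩ <;>
  · refine MonoidHom.ext fun y => ?_
    obtain ⟨x, rfl⟩ := projH_surjective A y
    simp [hf]

/-- The automorphism of a semidirect product with abelian normal factor that inverts this
factor. -/
def invLeft {N G : Type*} [CommGroup N] [Group G] (φ : G →* MulAut N) : MulAut (N ⋊[φ] G) where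
  toFun y := ⟨y.left⁻¹, y.right⟩
  invFun y := ⟨y.left⁻¹, y.right⟩
  left_inv y := by ext1 <;> simp
  right_inv y := by ext1 <;> simp
  map_mul' y z := by ext1 <;> simp [mul_comm]

/-- Two surjective homomorphisms with the same kernel have isomorphic targets. -/
lemma nonempty_mulEquiv_of_ker_eq {P G K : Type*} [Group P] [Group G] [Group K] {f : P →* G}
    {g : P →* K} (hf : Function.Surjective f) (hg : Function.Surjective g) (h : f.ker = g.ker) :
    Nonempty (G ≃* K) :=
  ⟨(QuotientGroup.quotientKerEquivOfSurjective f hf).symm.trans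
    ((QuotientGroup.quotientMulEquivOfEq h).trans
      (QuotientGroup.quotientKerEquivOfSurjective g hg))⟩

end Quotients

/-- The homomorphism `(j, e) ↦ (-1) ^ e * M ^ j`. -/
def signedPow (M : GL2Z) : Multiplicative ℤ × Multiplicative ℤ →* GL2Z :=
  MonoidHom.noncommCoprod (zpowersHom _ M) (zpowersHom _ (-1)) fun j e => by
    simp

lemma signedPow_apply (M : GL2Z) (j e : ℤ) : signedPow M (ofAdd j, ofAdd e) = M ^ j * (-1) ^ e :=
  rfl

lemma exists_signedPow_eq_zpow_iff {A M : GL2Z} {ℓ : ℕ} (hA : IsAnosov A)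
    (hAM : A = M ^ (ℓ : ℤ)) (j e : ℤ) :
    (∃ k : ℤ, signedPow M (ofAdd j, ofAdd e) = A ^ k) ↔ (ℓ : ℤ) ∣ j ∧ (2 : ℤ) ∣ e := by
  have hM : ∀ k : ℤ, M ^ k = 1 → k = 0 := by
    intro k hk
    by_contra hne
    apply hA.pow_ne_one (Int.natAbs_ne_zero.2 hne)
    have hk' : M ^ k.natAbs = 1 := by
      rcases Int.natAbs_eq k with h | h <;> rw [h] at hk
      · exact_mod_cast hk
      · rw [_root_.zpow_neg, inv_eq_one] at hk
        exact_mod_cast hk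
    rw [hAM, zpow_natCast, pow_right_comm, hk', one_pow]
  have hneg : (-1 : GL2Z) ≠ 1 := fun h => by
    have h' := congrArg (fun B : GL2Z => B.val 0 0) h
    simp at h'
  simp only [signedPow_apply, hAM, ← _root_.zpow_mul]
  constructor
  · rintro ⟨k, hk⟩
    have he : (2 : ℤ) ∣ e := by
      by_contra hodd
      rw [← even_iff_two_dvd, Int.not_even_iff_odd] at hodd
      rw [hodd.neg_one_zpow, ← eq_inv_mul_iff_mul_eq, ← _root_.zpow_neg,
        ← _root_.zpow_add] at hk
      have h2 : M ^ ((-j + ℓ * k) * 2) = 1 := by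
        rw [_root_.zpow_mul, ← hk]
        norm_num
      have h0 : -j + ℓ * k = 0 := by have := hM _ h2; omega
      rw [h0, _root_.zpow_zero] at hk
      exact hneg hk
    refine ⟨⟨k, ?_⟩, he⟩
    rw [(even_iff_two_dvd.2 he).neg_one_zpow, mul_one] at hk
    have h0 := hM (j - ℓ * k) (by rw [_root_.zpow_sub, hk, mul_inv_cancel])
    omega
  · rintro ⟨⟨k, rfl⟩, he⟩
    exact ⟨k, by rw [(even_iff_two_dvd.2 he).neg_one_zpow, mul_one]⟩

/-- Let `A` be Anosov with `R(A) = ∅`, `M₀` a primitive root of `A`, and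
`A = M₀ ^ ℓ` with `ℓ ≥ 1`. Then `Out(E_A) ≅ (H ⋊ ℤ/ℓ) ⋊ ℤ/2`, where the generator of `ℤ/ℓ`
acts on `H = (ℤ × ℤ)/((I - A)(ℤ × ℤ))` by the automorphism induced by `M₀`, and the nontrivial
element of `ℤ/2` acts on `H` by `-1` and on `ℤ/ℓ` as the identity. -/
theorem stmt9 (A M₀ : GL2Z) (ℓ : ℕ) (hℓ : 1 ≤ ℓ) (hA : IsAnosov A)
    (hR : {B : GL2Z | B * A * B⁻¹ = A⁻¹} = ∅)
    (hC : ∀ B : GL2Z, B * A * B⁻¹ = A ↔ ∃ j : ℤ, B = M₀ ^ j ∨ B = -(M₀ ^ j))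
    (hAM : A = M₀ ^ (ℓ : ℤ)) :
    ∃ ψ : Multiplicative (ZMod ℓ) →* MulAut (Multiplicative (HGrp A)),
      (∀ x : ℤ × ℤ, ψ (Multiplicative.ofAdd 1)
          (Multiplicative.ofAdd (QuotientAddGroup.mk x)) =
        Multiplicative.ofAdd (QuotientAddGroup.mk
          (mulVec2 (M₀ : Matrix (Fin 2) (Fin 2) ℤ) x))) ∧
      ∃ ψ' : Multiplicative (ZMod 2) →*
          MulAut (Multiplicative (HGrp A) ⋊[ψ] Multiplicative (ZMod ℓ)),
        (∀ y : Multiplicative (HGrp A) ⋊[ψ] Multiplicative (ZMod ℓ),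
          (ψ' (Multiplicative.ofAdd 1) y).left = (y.left)⁻¹ ∧
          (ψ' (Multiplicative.ofAdd 1) y).right = y.right) ∧
        Nonempty ((OutG (EA A)) ≃*
          ((Multiplicative (HGrp A) ⋊[ψ] Multiplicative (ZMod ℓ)) ⋊[ψ']
            Multiplicative (ZMod 2))) := by
  have hcomm : ∀ p, Commute (signedPow M₀ p) A := by
    rintro ⟨j, e⟩
    refine mul_inv_eq_iff_eq_mul.1 ((hC _).2 ⟨j.toAdd, ?_⟩)
    have hp : signedPow M₀ (j, e) = M₀ ^ j.toAdd * (-1) ^ e.toAdd := rfl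
    rw [hp]
    rcases Int.even_or_odd e.toAdd with he | he
    · exact Or.inl (by rw [he.neg_one_zpow, mul_one])
    · exact Or.inr (by rw [he.neg_one_zpow, mul_neg_one])
  obtain ⟨σ, hσ⟩ := exists_induced_aut (A := A) (B := M₀)
    (by rw [hAM]; exact (Commute.refl M₀).zpow_right _)
  have hσpow : ∀ (k : ℤ) x, (σ ^ k) (projH A x) = projH A (glHom (M₀ ^ k) x) := fun k x => by
    rw [map_zpow]
    exact MulAut.zpow_apply_of_semiconj _ _ _ hσ k x
  have hσℓ : σ ^ ℓ = 1 := by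
    refine MulEquiv.ext fun y => ?_
    obtain ⟨x, rfl⟩ := projH_surjective A y
    have h := (projH_eq_one_iff A _).2 ⟨x, rfl⟩
    rw [map_mul, map_inv, mul_inv_eq_one] at h
    rw [← zpow_natCast, hσpow, ← hAM, MulAut.one_apply, h]
  obtain ⟨ψ, hψ⟩ := exists_zmod_hom ℓ σ hσℓ
  have hψ1 : ψ (ofAdd 1) = σ := by simpa using hψ 1
  refine ⟨ψ, fun x => by rw [hψ1]; exact hσ (ofAdd x), ?_⟩
  have hι : invLeft ψ ^ 2 = 1 := by
    ext y : 1
    rw [pow_two, MulAut.mul_apply]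
    exact (invLeft ψ).left_inv y
  obtain ⟨ψ', hψ'⟩ := exists_zmod_hom 2 (invLeft ψ) hι
  have hψ'1 : ψ' (ofAdd 1) = invLeft ψ := by simpa using hψ' 1
  refine ⟨ψ', fun y => by rw [hψ'1]; exact ⟨rfl, rfl⟩, ?_⟩
  have hιpow : ∀ (e : ℤ) x a, (invLeft ψ ^ e) ⟨projH A x, a⟩ =
      ⟨projH A (glHom ((-1) ^ e) x), a⟩ := fun e x a => by
    rw [map_zpow]
    refine MulAut.zpow_apply_of_semiconj
      (fun x => (⟨projH A x, a⟩ : Multiplicative (HGrp A) ⋊[ψ] Multiplicative (ZMod ℓ))) _ _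
      (fun x => ?_) e x
    simp [glHom_neg_one, invLeft]
  let g : Multiplicative (ℤ × ℤ) ⋊[glHom.comp (signedPow M₀)]
      (Multiplicative ℤ × Multiplicative ℤ) →*
      (Multiplicative (HGrp A) ⋊[ψ] Multiplicative (ZMod ℓ)) ⋊[ψ'] Multiplicative (ZMod 2) :=
    MonoidHom.mk' (fun p => ⟨⟨projH A p.left, ofAdd (p.right.1.toAdd : ZMod ℓ)⟩,
      ofAdd (p.right.2.toAdd : ZMod 2)⟩) (by
        rintro ⟨v, j, e⟩ ⟨w, k, f⟩
        have hp : signedPow M₀ (j, e) = M₀ ^ j.toAdd * (-1) ^ e.toAdd := rfl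
        ext1
        · ext1
          · simp [-mk_eq_inl_mul_inr, -map_zpow, hψ, hψ', hιpow, hσpow, hp]
          · simp [-mk_eq_inl_mul_inr, -map_zpow, hψ', hιpow]
        · simp)
  refine nonempty_mulEquiv_of_ker_eq
    (f := (QuotientGroup.mk' _).comp (affineAut (signedPow M₀) hcomm)) (g := g) ?_ ?_ ?_
  · refine (QuotientGroup.mk'_surjective _).comp fun φ => ?_
    obtain ⟨v, B, hB, hl, hr⟩ := hA.exists_affine hR φ
    obtain ⟨c, hc⟩ : ∃ c, signedPow M₀ c = B := by
      obtain ⟨j, hj | hj⟩ := (hC B).1 hB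
      · exact ⟨(ofAdd j, ofAdd 0), by rw [signedPow_apply]; simp [hj]⟩
      · exact ⟨(ofAdd j, ofAdd 1), by rw [signedPow_apply]; simp [hj]⟩
    refine ⟨⟨v, c⟩, EA_aut_ext (fun n => ?_) ?_⟩
    · rw [affineAut_inl, hl, hc]
    · rw [affineAut_inr, hr]
  · rintro ⟨⟨h, a⟩, b⟩
    obtain ⟨v, rfl⟩ := projH_surjective A h
    obtain ⟨j, hj⟩ := ZMod.intCast_surjective a.toAdd
    obtain ⟨e, he⟩ := ZMod.intCast_surjective b.toAdd
    refine ⟨⟨v, ofAdd j, ofAdd e⟩, ?_⟩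
    ext1
    · ext1
      · rfl
      · exact congrArg ofAdd hj
    · exact congrArg ofAdd he
  · ext ⟨v, j, e⟩
    have hf := affineAut_mem_range_conj_iff (signedPow M₀) hcomm ⟨v, j, e⟩
    have hje := exists_signedPow_eq_zpow_iff hA hAM j.toAdd e.toAdd
    rw [MonoidHom.mem_ker, MonoidHom.comp_apply, QuotientGroup.mk'_apply,
      QuotientGroup.eq_one_iff, hf, ← projH_eq_one_iff]
    refine (and_congr_right' hje).trans ?_
    rw [← ZMod.intCast_zmod_eq_zero_iff_dvd]
    have h2 := ZMod.intCast_zmod_eq_zero_iff_dvd e.toAdd 2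
    rw [MonoidHom.mem_ker, SemidirectProduct.ext_iff, SemidirectProduct.ext_iff, and_assoc]
    exact and_congr_right' (and_congr_right' h2.symm)
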